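/- For every real α with 0 < α < 1 and every t > 0, the function x ↦ f(x,t,α) is integrable on (0,∞) and E_α(−t^α) = ∫_0^∞ f(x,t,α) dx. -/

import Mathlib

open scoped Real
open MeasureTheory

/-- The one-parameter Mittag-Leffler function (real version):
`E_α(x) = ∑_{j=0}^∞ x^j / Γ(jα + 1)`. -/
noncomputable def mittagLeffler (α x : ℝ) : ℝ :=
  ∑' j : ℕ, x ^ j / Real.Gamma ((j : ℝ) * α + 1)

/-- The kernel `f(x,t,α) = (sin(απ)/(απ)) · e^{−t x^{−1/α}} / (x² + 2x cos(απ) + 1)`. -/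
noncomputable def fKer (x t α : ℝ) : ℝ :=
  (Real.sin (α * π) / (α * π)) *
    Real.exp (-(t * x ^ (-(1 / α)))) / (x ^ 2 + 2 * x * Real.cos (α * π) + 1)

/-- The jump `φ(x + iπ) - φ(x - iπ)` of `φ` across the two sides of the strip `|Im w| ≤ π`. -/
noncomputable def stripJump (φ : ℂ → ℂ) (x : ℝ) : ℂ :=
  φ (x + π * Complex.I) - φ (x + (-π : ℝ) * Complex.I)

/-- The Hankel contour integral in logarithmic coordinates: `φ` is integrated along the boundary of
the half-strip `Re w ≥ 1`, `|Im w| ≤ π`. -/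
noncomputable def hankel (φ : ℂ → ℂ) : ℂ :=
  (∫ x in Set.Ioi (1 : ℝ), stripJump φ x) +
    Complex.I * ∫ y in (-π)..π, φ ((1 : ℝ) + y * Complex.I)

/-- The integrand `e^{t s} s^{-a-1} ds` of Hankel's formula under `s = e^w`. -/
noncomputable def hankelIntegrand (t a : ℝ) (w : ℂ) : ℂ :=
  Complex.exp (t * Complex.exp w - a * w)

section ChangeOfVariables

variable {F : Type*} [NormedAddCommGroup F] [NormedSpace ℝ F]

lemma image_exp_mul_univ {c : ℝ} (hc : c ≠ 0) :
    (fun v : ℝ => Real.exp (c * v)) '' Set.univ = Set.Ioi 0 := by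
  ext x
  simp only [Set.image_univ, Set.mem_range, Set.mem_Ioi]
  constructor
  · rintro ⟨v, rfl⟩
    exact Real.exp_pos _
  · intro hx
    refine ⟨Real.log x / c, ?_⟩
    rw [mul_div_cancel₀ _ hc, Real.exp_log hx]

lemma hasDerivAt_exp_mul (c v : ℝ) :
    HasDerivAt (fun v : ℝ => Real.exp (c * v)) (c * Real.exp (c * v)) v := by
  have := ((hasDerivAt_id v).const_mul c).exp
  simpa [mul_comm] using this

lemma injOn_exp_mul {c : ℝ} (hc : c ≠ 0) :
    Set.InjOn (fun v : ℝ => Real.exp (c * v)) Set.univ := by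
  intro x _ y _ h
  exact mul_left_cancel₀ hc (Real.exp_injective h)

lemma integrableOn_Ioi_iff_integrable_comp_exp {c : ℝ} (hc : c ≠ 0) (g : ℝ → F) :
    IntegrableOn g (Set.Ioi 0) ↔
      Integrable fun v : ℝ => |c * Real.exp (c * v)| • g (Real.exp (c * v)) := by
  rw [← image_exp_mul_univ hc, integrableOn_image_iff_integrableOn_abs_deriv_smul
    MeasurableSet.univ (fun x _ => (hasDerivAt_exp_mul c x).hasDerivWithinAt) (injOn_exp_mul hc),
    integrableOn_univ]

lemma integral_Ioi_eq_integral_comp_exp {c : ℝ} (hc : c ≠ 0) (g : ℝ → F) :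
    ∫ x in Set.Ioi 0, g x =
      ∫ v : ℝ, |c * Real.exp (c * v)| • g (Real.exp (c * v)) := by
  rw [← image_exp_mul_univ hc, integral_image_eq_integral_abs_deriv_smul
    MeasurableSet.univ (fun x _ => (hasDerivAt_exp_mul c x).hasDerivWithinAt) (injOn_exp_mul hc),
    setIntegral_univ]

end ChangeOfVariables

lemma abs_smul_rpow_exp_eq (t a v : ℝ) :
    |1 * Real.exp (1 * v)| • (Real.exp (1 * v) ^ (a - 1) * Real.exp (-(t * Real.exp (1 * v)))) =
      Real.exp (-(t * Real.exp v) + a * v) := by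
  rw [one_mul, one_mul, abs_of_pos (Real.exp_pos _), ← Real.exp_mul, smul_eq_mul, ← Real.exp_add,
    ← Real.exp_add]
  congr 1
  ring

lemma integrable_exp_neg_mul_exp_add {t a : ℝ} (ht : 0 < t) (ha : 0 < a) :
    Integrable fun x : ℝ => Real.exp (-(t * Real.exp x) + a * x) := by
  have h := integrableOn_rpow_mul_exp_neg_mul_rpow (p := 1) (s := a - 1) (b := t)
    (by linarith) one_pos ht
  simp only [Real.rpow_one, neg_mul] at h
  rw [integrableOn_Ioi_iff_integrable_comp_exp one_ne_zero] at h
  simpa only [abs_smul_rpow_exp_eq] using h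

lemma integral_exp_neg_mul_exp_add {t a : ℝ} (ht : 0 < t) (ha : 0 < a) :
    ∫ x : ℝ, Real.exp (-(t * Real.exp x) + a * x) = t ^ (-a) * Real.Gamma a := by
  have h := Real.integral_rpow_mul_exp_neg_mul_Ioi ha ht
  rw [integral_Ioi_eq_integral_comp_exp one_ne_zero] at h
  simp only [abs_smul_rpow_exp_eq] at h
  rw [h, one_div, Real.inv_rpow ht.le, Real.rpow_neg ht.le]

lemma integrableOn_exp_neg_mul_exp_add {t : ℝ} (ht : 0 < t) (a R : ℝ) :
    IntegrableOn (fun x : ℝ => Real.exp (-(t * Real.exp x) + a * x)) (Set.Ioi R) := by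
  have h := ((integrable_exp_neg_mul_exp_add ht (a := |a| + 1) (by positivity)).integrableOn
    (s := Set.Ioi R)).const_mul (Real.exp (-(|a| + 1 - a) * R))
  refine Integrable.mono' h (by fun_prop) ?_
  refine (ae_restrict_mem measurableSet_Ioi).mono fun x hx => ?_
  rw [Real.norm_eq_abs, abs_of_pos (Real.exp_pos _), ← Real.exp_add]
  apply Real.exp_le_exp.2
  have h1 := le_abs_self a
  have h2 : R < x := hx
  nlinarith

lemma norm_hankelIntegrand (t a x y : ℝ) :
    ‖hankelIntegrand t a (x + y * Complex.I)‖ =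
      Real.exp (t * (Real.exp x * Real.cos y) - a * x) := by
  rw [hankelIntegrand, Complex.norm_exp]
  simp [Complex.exp_re]

lemma exp_add_pi_mul_I (x : ℝ) : Complex.exp (x + π * Complex.I) = -Complex.exp x := by
  rw [Complex.exp_add, Complex.exp_pi_mul_I]; ring

lemma exp_add_neg_pi_mul_I (x : ℝ) :
    Complex.exp (x + (-π : ℝ) * Complex.I) = -Complex.exp x := by
  rw [Complex.exp_add, Complex.ofReal_neg, neg_mul, Complex.exp_neg, Complex.exp_pi_mul_I]
  norm_num

lemma stripJump_hankelIntegrand (t a x : ℝ) :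
    stripJump (hankelIntegrand t a) x =
      (Real.exp (-(t * Real.exp x) + (-a) * x) : ℝ) * (-(2 * Complex.I * Real.sin (a * π))) := by
  have h1 : hankelIntegrand t a (x + π * Complex.I) =
      (Real.exp (-(t * Real.exp x) + (-a) * x) : ℝ) * Complex.exp (-(a * π : ℝ) * Complex.I) := by
    rw [hankelIntegrand, exp_add_pi_mul_I, Complex.ofReal_exp, ← Complex.exp_add]
    congr 1
    push_cast
    ring
  have h2 : hankelIntegrand t a (x + (-π : ℝ) * Complex.I) =
      (Real.exp (-(t * Real.exp x) + (-a) * x) : ℝ) * Complex.exp ((a * π : ℝ) * Complex.I) := by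
    rw [hankelIntegrand, exp_add_neg_pi_mul_I, Complex.ofReal_exp, ← Complex.exp_add]
    congr 1
    push_cast
    ring
  rw [stripJump, h1, h2, ← mul_sub, Complex.ofReal_sin, Complex.sin]
  linear_combination (Real.exp (-(t * Real.exp x) + (-a) * x) : ℂ) *
    (Complex.exp (-(a * π : ℝ) * Complex.I) - Complex.exp ((a * π : ℝ) * Complex.I)) *
      Complex.I_sq

lemma differentiable_hankelIntegrand (t a : ℝ) : Differentiable ℂ (hankelIntegrand t a) := by
  unfold hankelIntegrand
  fun_prop

lemma integrableOn_stripJump_hankelIntegrand {t : ℝ} (ht : 0 < t) (a R : ℝ) :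
    IntegrableOn (stripJump (hankelIntegrand t a)) (Set.Ioi R) := by
  have h := (integrableOn_exp_neg_mul_exp_add ht (-a) R).ofReal (𝕜 := ℂ)
  exact (h.mul_const (-(2 * Complex.I * Real.sin (a * π)))).congr
    (Filter.Eventually.of_forall fun x => (stripJump_hankelIntegrand t a x).symm)

/-- The vertical side of the half-strip may be pushed to `-∞`. -/
lemma hankel_eq_integral_stripJump {φ : ℂ → ℂ} {B : ℝ → ℝ}
    (hd : ∀ w : ℂ, |w.im| ≤ π → DifferentiableAt ℂ φ w) (hg : Integrable (stripJump φ))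
    (hB : Filter.Tendsto B Filter.atBot (nhds 0))
    (hb : ∀ᶠ R in Filter.atBot, ∀ y : ℝ, ‖φ ((R : ℝ) + y * Complex.I)‖ ≤ B R) :
    hankel φ = ∫ x, stripJump φ x := by
  have hcont : ∀ y : ℝ, |y| ≤ π → Continuous fun x : ℝ => φ (x + y * Complex.I) := by
    intro y hy
    refine continuous_iff_continuousAt.2 fun x => ?_
    have h := (hd (x + y * Complex.I) (by simpa using hy)).continuousAt
    exact ContinuousAt.comp (f := fun x : ℝ => (x + y * Complex.I : ℂ)) h (by fun_prop)
  have hrect : ∀ R : ℝ, hankel φ = (∫ x in Set.Ioi R, stripJump φ x) +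
      Complex.I * ∫ y in (-π)..π, φ (R + y * Complex.I) := by
    intro R
    have h := Complex.integral_boundary_rect_eq_zero_of_differentiableOn φ
      (R + (-π : ℝ) * Complex.I) ((1 : ℝ) + π * Complex.I) ?_
    · have e1 : ((R : ℂ) + (-π : ℝ) * Complex.I).re = R := by simp
      have e2 : ((R : ℂ) + (-π : ℝ) * Complex.I).im = -π := by simp
      have e3 : (((1 : ℝ) : ℂ) + π * Complex.I).re = 1 := by simp
      have e4 : (((1 : ℝ) : ℂ) + π * Complex.I).im = π := by simp
      rw [e1, e2, e3, e4] at h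
      have hj : ∫ x in R..1, stripJump φ x = (∫ x in R..1, φ (x + π * Complex.I)) -
          ∫ x in R..1, φ (x + (-π : ℝ) * Complex.I) :=
        intervalIntegral.integral_sub
          ((hcont π (abs_of_pos Real.pi_pos).le).intervalIntegrable _ _)
          ((hcont (-π) (by rw [abs_neg, abs_of_pos Real.pi_pos])).intervalIntegrable _ _)
      rw [← intervalIntegral.integral_interval_add_Ioi (hg.integrableOn (s := Set.Ioi R))
        (hg.integrableOn (s := Set.Ioi 1)), hj, hankel]
      simp only [smul_eq_mul] at h
      linear_combination h
    · intro w hw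
      refine (hd w ?_).differentiableWithinAt
      have h2 := hw.2
      simp only [Set.mem_preimage] at h2
      have : w.im ∈ Set.uIcc (-π) π := by simpa using h2
      rw [Set.uIcc_of_le (by linarith [Real.pi_pos])] at this
      exact abs_le.2 this
  have h1 : Filter.Tendsto (fun R : ℝ => ∫ x in Set.Ioi R, stripJump φ x) Filter.atBot
      (nhds (∫ x, stripJump φ x)) := by
    have hcov : AECover (volume : Measure ℝ) Filter.atBot (fun R : ℝ => Set.Ioi R) :=
      aecover_Ioi Filter.tendsto_id
    exact hcov.integral_tendsto_of_countably_generated hg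
  have h2 : Filter.Tendsto (fun R : ℝ => Complex.I * ∫ y in (-π)..π, φ (R + y * Complex.I))
      Filter.atBot (nhds 0) := by
    have hB' : Filter.Tendsto (fun R => B R * |π - -π|) Filter.atBot (nhds 0) := by
      simpa using hB.mul_const |π - -π|
    refine squeeze_zero_norm' ?_ hB'
    filter_upwards [hb] with R hR
    rw [norm_mul, Complex.norm_I, one_mul]
    exact intervalIntegral.norm_integral_le_of_norm_le_const fun y _ => hR y
  have h3 := h1.add h2
  rw [add_zero] at h3
  refine tendsto_nhds_unique (tendsto_const_nhds.congr hrect) h3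

/-- The integral of a derivative along the Hankel contour vanishes. -/
lemma hankel_deriv_eq_zero {φ φ' : ℂ → ℂ} (hd : ∀ w, HasDerivAt φ (φ' w) w)
    (hφ' : Continuous φ')
    (hi : IntegrableOn (stripJump φ) (Set.Ioi 1)) (hi' : IntegrableOn (stripJump φ') (Set.Ioi 1)) :
    hankel φ' = 0 := by
  have hline : ∀ x y : ℝ, HasDerivAt (fun x : ℝ => φ (x + y * Complex.I))
      (φ' (x + y * Complex.I)) x := by
    intro x y
    have h1 : HasDerivAt (fun x : ℝ => (x + y * Complex.I : ℂ)) 1 x :=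
      Complex.ofRealCLM.hasDerivAt.add_const _
    have h2 := (hd (x + y * Complex.I)).comp x h1
    rw [mul_one] at h2
    exact h2
  have hj : ∀ x : ℝ, HasDerivAt (stripJump φ) (stripJump φ' x) x := fun x =>
    (hline x π).sub (hline x (-π))
  have h0 := tendsto_zero_of_hasDerivAt_of_integrableOn_Ioi (fun x _ => hj x) hi' hi
  have h1 := integral_Ioi_of_hasDerivAt_of_tendsto (hj 1).continuousAt.continuousWithinAt
    (fun x _ => hj x) hi' h0
  have hv : ∀ y : ℝ, HasDerivAt (fun y : ℝ => φ ((1 : ℝ) + y * Complex.I))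
      (φ' ((1 : ℝ) + y * Complex.I) * Complex.I) y := by
    intro y
    have h1 : HasDerivAt (fun y : ℝ => ((1 : ℝ) + y * Complex.I : ℂ)) Complex.I y := by
      simpa using (Complex.ofRealCLM.hasDerivAt.mul_const Complex.I).const_add ((1 : ℝ) : ℂ)
    exact (hd _).comp y h1
  have h2 := intervalIntegral.integral_eq_sub_of_hasDerivAt (a := -π) (b := π) (fun y _ => hv y)
    (Continuous.intervalIntegrable (by fun_prop) _ _)
  rw [intervalIntegral.integral_mul_const] at h2
  rw [hankel, h1, mul_comm Complex.I, h2, stripJump]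
  ring

lemma hasDerivAt_hankelIntegrand (t a : ℝ) (w : ℂ) :
    HasDerivAt (hankelIntegrand t a)
      (t * hankelIntegrand t (a - 1) w - a * hankelIntegrand t a w) w := by
  have h : HasDerivAt (fun w : ℂ => t * Complex.exp w - a * w) (t * Complex.exp w - a * 1) w :=
    ((Complex.hasDerivAt_exp w).const_mul _).sub ((hasDerivAt_id w).const_mul _)
  have e : hankelIntegrand t (a - 1) w = hankelIntegrand t a w * Complex.exp w := by
    rw [hankelIntegrand, hankelIntegrand, ← Complex.exp_add]
    congr 1
    push_cast
    ring
  refine h.cexp.congr_deriv ?_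
  rw [e, hankelIntegrand]
  ring

lemma mul_hankel_hankelIntegrand {t : ℝ} (ht : 0 < t) (a : ℝ) :
    a * hankel (hankelIntegrand t a) = t * hankel (hankelIntegrand t (a - 1)) := by
  have hc := fun b : ℝ => (differentiable_hankelIntegrand t b).continuous
  have hi := fun b : ℝ => integrableOn_stripJump_hankelIntegrand ht b 1
  have hjump : stripJump (fun w => t * hankelIntegrand t (a - 1) w - a * hankelIntegrand t a w) =
      fun x => t * stripJump (hankelIntegrand t (a - 1)) x -
        a * stripJump (hankelIntegrand t a) x := by
    funext x
    simp only [stripJump]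
    ring
  have hc1 := hc (a - 1)
  have hc2 := hc a
  have h := hankel_deriv_eq_zero (hasDerivAt_hankelIntegrand t a) (by fun_prop) (hi a) (by
    rw [hjump]
    exact ((hi (a - 1)).const_mul _).sub ((hi a).const_mul _))
  rw [hankel, hjump, integral_sub ((hi (a - 1)).const_mul _) ((hi a).const_mul _),
    intervalIntegral.integral_sub (Continuous.intervalIntegrable (by fun_prop) _ _)
      (Continuous.intervalIntegrable (by fun_prop) _ _), integral_const_mul, integral_const_mul,
    intervalIntegral.integral_const_mul, intervalIntegral.integral_const_mul] at h
  simp only [hankel]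
  linear_combination -h

lemma hankel_hankelIntegrand_zero (t : ℝ) : hankel (hankelIntegrand t 0) = 2 * π * Complex.I := by
  have hj : stripJump (hankelIntegrand t 0) = 0 := by
    funext x
    rw [stripJump_hankelIntegrand]
    simp
  have hdiff : Differentiable ℂ fun z : ℂ => Complex.exp (t * z) := by fun_prop
  have havg := (hdiff.diffContOnCl (s := Metric.ball 0 |Real.exp 1|)).circleAverage
  rw [Real.circleAverage_def] at havg
  have hcirc : ∀ θ : ℝ, Complex.exp (t * circleMap 0 (Real.exp 1) θ) =
      hankelIntegrand t 0 ((1 : ℝ) + θ * Complex.I) := by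
    intro θ
    simp [hankelIntegrand, circleMap, Complex.exp_add]
  simp only [hcirc] at havg
  have hper : Function.Periodic
      (fun θ : ℝ => hankelIntegrand t 0 ((1 : ℝ) + θ * Complex.I)) (2 * π) := by
    intro θ
    simp only [← hcirc]
    rw [periodic_circleMap]
  have hint := hper.intervalIntegral_add_eq 0 (-π)
  rw [zero_add, show -π + 2 * π = π by ring] at hint
  rw [hint, mul_zero, Complex.exp_zero, inv_smul_eq_iff₀ (by positivity)] at havg
  rw [hankel, hj, havg]
  simp [mul_comm]

lemma hankel_hankelIntegrand_of_neg {t a : ℝ} (ht : 0 < t) (ha : a < 0) (ha1 : -1 < a) :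
    hankel (hankelIntegrand t a) = 2 * π * Complex.I * (t ^ a / Real.Gamma (a + 1) : ℝ) := by
  have hint := integrable_exp_neg_mul_exp_add ht (a := -a) (by linarith)
  have hj : stripJump (hankelIntegrand t a) = fun x : ℝ =>
      (Real.exp (-(t * Real.exp x) + (-a) * x) : ℂ) * (-(2 * Complex.I * Real.sin (a * π))) := by
    funext x
    exact stripJump_hankelIntegrand t a x
  rw [hankel_eq_integral_stripJump (B := fun R => Real.exp (t * Real.exp R) * Real.exp (-a * R))
    (fun w _ => differentiable_hankelIntegrand t a w)
    (by rw [hj]; exact (hint.ofReal (𝕜 := ℂ)).mul_const _), hj, integral_mul_const,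
    integral_complex_ofReal, integral_exp_neg_mul_exp_add ht (by linarith), neg_neg]
  · have hG := Real.Gamma_mul_Gamma_one_sub (-a)
    have hs : Real.sin (a * π) < 0 := by
      have := Real.sin_pos_of_pos_of_lt_pi (x := -a * π) (by nlinarith [Real.pi_pos])
        (by nlinarith [Real.pi_pos])
      rw [neg_mul, Real.sin_neg] at this
      linarith
    have hΓ : Real.Gamma (a + 1) ≠ 0 := (Real.Gamma_pos_of_pos (by linarith)).ne'
    rw [show (1 : ℝ) - -a = a + 1 by ring, show π * -a = -(a * π) by ring, Real.sin_neg,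
      eq_div_iff (by linarith)] at hG
    have key : t ^ a * Real.Gamma (-a) * (-(2 * Real.sin (a * π))) =
        2 * π * (t ^ a / Real.Gamma (a + 1)) := by
      field_simp
      linear_combination hG
    have key' := congrArg (fun r : ℝ => (r : ℂ) * Complex.I) key
    push_cast at key' ⊢
    linear_combination key'
  · have h1 : Filter.Tendsto (fun R : ℝ => Real.exp (t * Real.exp R)) Filter.atBot (nhds 1) := by
      have := (Real.continuous_exp.tendsto _).comp (Real.tendsto_exp_atBot.const_mul t)
      simpa [Function.comp_def] using this
    have h2 : Filter.Tendsto (fun R : ℝ => Real.exp (-a * R)) Filter.atBot (nhds 0) :=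
      Real.tendsto_exp_atBot.comp (Filter.tendsto_id.const_mul_atBot (by linarith))
    simpa using h1.mul h2
  · refine Filter.Eventually.of_forall fun R y => ?_
    rw [norm_hankelIntegrand, ← Real.exp_add]
    apply Real.exp_le_exp.2
    have := mul_le_mul_of_nonneg_left (Real.cos_le_one y) (mul_pos ht (Real.exp_pos R)).le
    linarith

/-- Hankel's formula for the reciprocal Gamma function. -/
theorem hankel_hankelIntegrand {t a : ℝ} (ht : 0 < t) (ha : -1 < a) :
    hankel (hankelIntegrand t a) = 2 * π * Complex.I * (t ^ a / Real.Gamma (a + 1) : ℝ) := by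
  obtain ⟨n, hn⟩ := exists_nat_gt a
  induction n generalizing a with
  | zero => exact hankel_hankelIntegrand_of_neg ht (by simpa using hn) ha
  | succ n ih =>
    rcases lt_trichotomy a 0 with h | rfl | h
    · exact hankel_hankelIntegrand_of_neg ht h ha
    · simp [hankel_hankelIntegrand_zero]
    · have h1 := mul_hankel_hankelIntegrand ht a
      rw [ih (a := a - 1) (by linarith) (by push_cast at hn; linarith), sub_add_cancel] at h1
      have hac : (a : ℂ) ≠ 0 := by exact_mod_cast h.ne'
      apply mul_left_cancel₀ hac
      have hΓ : Real.Gamma a ≠ 0 := (Real.Gamma_pos_of_pos h).ne'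
      have key : t * (t ^ (a - 1) / Real.Gamma a) = a * (t ^ a / Real.Gamma (a + 1)) := by
        rw [Real.Gamma_add_one h.ne', Real.rpow_sub_one ht.ne']
        field_simp
      have key' := congrArg (fun r : ℝ => (r : ℂ)) key
      push_cast at key' h1 ⊢
      rw [h1]
      linear_combination 2 * π * Complex.I * key'

/-- The sum of the Hankel integrands of the terms of the Mittag-Leffler series. -/
noncomputable def resolventIntegrand (t α : ℝ) (w : ℂ) : ℂ :=
  Complex.exp (t * Complex.exp w) / (1 + Complex.exp (-(α * w)))

lemma neg_one_pow_mul_hankelIntegrand (t α : ℝ) (k : ℕ) (w : ℂ) :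
    (-1) ^ k * hankelIntegrand t (k * α) w =
      Complex.exp (t * Complex.exp w) * (-Complex.exp (-(α * w))) ^ k := by
  rw [neg_pow (Complex.exp (-(α * w))), ← Complex.exp_nat_mul, hankelIntegrand, sub_eq_add_neg,
    Complex.exp_add]
  push_cast
  rw [show (k : ℂ) * -(α * w) = -(k * α * w) by ring]
  ring

lemma hasSum_hankelIntegrand {t α : ℝ} {w : ℂ} (hw : 0 < α * w.re) :
    HasSum (fun k : ℕ => (-1) ^ k * hankelIntegrand t (k * α) w) (resolventIntegrand t α w) := by
  simp only [neg_one_pow_mul_hankelIntegrand]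
  have hn : ‖-Complex.exp (-(α * w))‖ < 1 := by
    rw [norm_neg, Complex.norm_exp]
    simpa using hw
  have := (hasSum_geometric_of_norm_lt_one hn).mul_left (Complex.exp (t * Complex.exp w))
  rwa [sub_neg_eq_add, ← div_eq_mul_inv] at this

lemma norm_neg_one_pow_mul_hankelIntegrand_le {t α x y : ℝ} (hα : 0 ≤ α) (hx : 1 ≤ x) (k : ℕ) :
    ‖(-1) ^ k * hankelIntegrand t (k * α) (x + y * Complex.I)‖ ≤
      Real.exp (-α) ^ k * Real.exp (t * (Real.exp x * Real.cos y)) := by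
  rw [norm_mul, norm_pow, norm_neg, norm_one, one_pow, one_mul, norm_hankelIntegrand,
    ← Real.exp_nat_mul, ← Real.exp_add]
  apply Real.exp_le_exp.2
  have : (k : ℝ) * α * 1 ≤ k * α * x := mul_le_mul_of_nonneg_left hx (by positivity)
  linarith

lemma hasSum_hankel_hankelIntegrand {t α : ℝ} (ht : 0 < t) (hα : 0 < α) :
    HasSum (fun k : ℕ => (-1) ^ k * hankel (hankelIntegrand t (k * α)))
      (hankel (resolventIntegrand t α)) := by
  have hq : Summable fun k : ℕ => Real.exp (-α) ^ k :=
    summable_geometric_of_lt_one (Real.exp_pos _).le (by simpa using hα)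
  have hc := fun b : ℝ => (differentiable_hankelIntegrand t b).continuous
  have hh : HasSum (fun k : ℕ => ∫ x in Set.Ioi (1 : ℝ),
      (-1) ^ k * stripJump (hankelIntegrand t (k * α)) x)
      (∫ x in Set.Ioi (1 : ℝ), stripJump (resolventIntegrand t α) x) := by
    refine hasSum_integral_of_dominated_convergence
      (fun k x => Real.exp (-α) ^ k * (2 * Real.exp (-(t * Real.exp x) + 0 * x))) ?_ ?_ ?_ ?_ ?_
    · intro k
      exact ((integrableOn_stripJump_hankelIntegrand ht _ 1).const_mul _).aestronglyMeasurable
    · intro k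
      refine (ae_restrict_mem measurableSet_Ioi).mono fun x (hx : 1 < x) => ?_
      have h1 := norm_neg_one_pow_mul_hankelIntegrand_le (t := t) (y := π) hα.le hx.le k
      have h2 := norm_neg_one_pow_mul_hankelIntegrand_le (t := t) (y := -π) hα.le hx.le k
      rw [Real.cos_neg] at h2
      rw [Real.cos_pi] at h1 h2
      rw [stripJump, mul_sub]
      refine (norm_sub_le _ _).trans ((add_le_add h1 h2).trans_eq ?_)
      rw [show t * (Real.exp x * -1) = -(t * Real.exp x) + 0 * x by ring]
      ring
    · exact Filter.Eventually.of_forall fun x => hq.mul_right _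
    · simp only [tsum_mul_right]
      exact ((integrableOn_exp_neg_mul_exp_add ht 0 1).const_mul _).const_mul _
    · refine (ae_restrict_mem measurableSet_Ioi).mono fun x (hx : 1 < x) => ?_
      have hpos : 0 < α * x := mul_pos hα (by linarith)
      have h1 := hasSum_hankelIntegrand (t := t) (α := α) (w := x + π * Complex.I)
        (by simpa using hpos)
      have h2 := hasSum_hankelIntegrand (t := t) (α := α) (w := x + (-π : ℝ) * Complex.I)
        (by simpa using hpos)
      simpa only [stripJump, mul_sub] using h1.sub h2
  have hv : HasSum (fun k : ℕ => ∫ y in (-π)..π,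
      (-1) ^ k * hankelIntegrand t (k * α) ((1 : ℝ) + y * Complex.I))
      (∫ y in (-π)..π, resolventIntegrand t α ((1 : ℝ) + y * Complex.I)) := by
    refine intervalIntegral.hasSum_integral_of_dominated_convergence
      (fun k y => Real.exp (-α) ^ k * Real.exp (t * (Real.exp 1 * Real.cos y))) ?_ ?_ ?_ ?_ ?_
    · intro k
      have := hc (k * α)
      exact Continuous.aestronglyMeasurable (by fun_prop)
    · intro k
      exact Filter.Eventually.of_forall fun y _ =>
        norm_neg_one_pow_mul_hankelIntegrand_le hα.le le_rfl k
    · exact Filter.Eventually.of_forall fun y _ => hq.mul_right _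
    · simp only [tsum_mul_right]
      exact Continuous.intervalIntegrable (by fun_prop) _ _
    · exact Filter.Eventually.of_forall fun y _ => hasSum_hankelIntegrand (by simpa using hα)
  have h := hh.add (hv.mul_left Complex.I)
  refine h.congr_fun ?_
  intro k
  rw [integral_const_mul, intervalIntegral.integral_const_mul, hankel]
  ring

lemma one_add_exp_ne_zero {α : ℝ} (hα0 : 0 < α) (hα1 : α < 1) {w : ℂ} (hw : |w.im| ≤ π) :
    1 + Complex.exp (-(α * w)) ≠ 0 := by
  intro h
  have him : (-(α * w)).im = -(α * w.im) := by simp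
  have hlt : |(-(α * w)).im| < π := by
    rw [him, abs_neg, abs_mul, abs_of_pos hα0]
    nlinarith [Real.pi_pos, abs_nonneg w.im]
  have hlog := Complex.log_exp (abs_lt.1 hlt).1 (abs_lt.1 hlt).2.le
  rw [show Complex.exp (-(α * w)) = -1 by linear_combination h, Complex.log_neg_one] at hlog
  rw [← hlog] at hlt
  simp [abs_of_pos Real.pi_pos] at hlt

lemma quadratic_lower_bound (c x : ℝ) :
    (1 - |c|) * (1 + x ^ 2) ≤ x ^ 2 + 2 * x * c + 1 := by
  have h1 : -(|c| * (2 * |x|)) ≤ 2 * x * c := by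
    have := neg_abs_le (2 * x * c)
    rw [abs_mul, abs_mul, abs_two] at this
    linarith
  have h2 : |c| * (2 * |x|) ≤ |c| * (1 + x ^ 2) := by
    apply mul_le_mul_of_nonneg_left _ (abs_nonneg c)
    nlinarith [sq_nonneg (|x| - 1), sq_abs x]
  linarith

lemma abs_cos_mul_pi_lt_one {α : ℝ} (hα0 : 0 < α) (hα1 : α < 1) : |Real.cos (α * π)| < 1 := by
  have hs : 0 < Real.sin (α * π) := Real.sin_pos_of_pos_of_lt_pi (by positivity)
    (by nlinarith [Real.pi_pos])
  rw [← sq_lt_one_iff_abs_lt_one]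
  nlinarith [Real.sin_sq_add_cos_sq (α * π)]

lemma quadratic_pos {α : ℝ} (hα0 : 0 < α) (hα1 : α < 1) (x : ℝ) :
    0 < x ^ 2 + 2 * x * Real.cos (α * π) + 1 :=
  (mul_pos (sub_pos.2 (abs_cos_mul_pi_lt_one hα0 hα1)) (by positivity)).trans_le
    (quadratic_lower_bound _ _)

lemma integrableOn_fKer {α t : ℝ} (hα0 : 0 < α) (hα1 : α < 1) (ht : 0 ≤ t) :
    IntegrableOn (fun x : ℝ => fKer x t α) (Set.Ioi 0) := by
  have hc := sub_pos.2 (abs_cos_mul_pi_lt_one hα0 hα1)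
  refine Integrable.mono' ((integrable_inv_one_add_sq.integrableOn (s := Set.Ioi 0)).const_mul
    (|Real.sin (α * π) / (α * π)| / (1 - |Real.cos (α * π)|))) ?_ ?_
  · unfold fKer
    exact Measurable.aestronglyMeasurable (by fun_prop)
  · refine (ae_restrict_mem measurableSet_Ioi).mono fun x (hx : 0 < x) => ?_
    rw [fKer, norm_div, norm_mul, Real.norm_eq_abs, Real.norm_eq_abs, Real.norm_eq_abs,
      abs_of_pos (quadratic_pos hα0 hα1 x), abs_of_pos (Real.exp_pos _), div_mul_eq_mul_div,
      ← div_eq_mul_inv, div_div]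
    have he : Real.exp (-(t * x ^ (-(1 / α)))) ≤ 1 := by
      rw [Real.exp_le_one_iff]
      have := Real.rpow_nonneg hx.le (-(1 / α))
      nlinarith [mul_nonneg ht this]
    rw [mul_comm (1 + x ^ 2)]
    exact div_le_div₀ (abs_nonneg _) (mul_le_of_le_one_right (abs_nonneg _) he) (by positivity)
      (quadratic_lower_bound _ _)

lemma stripJump_resolventIntegrand {α : ℝ} (hα0 : 0 < α) (hα1 : α < 1) (t v : ℝ) :
    stripJump (resolventIntegrand t α) v = 2 * π * Complex.I *
      (|-α * Real.exp (-α * v)| • fKer (Real.exp (-α * v)) t α : ℝ) := by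
  have hX : Real.exp (-α * v) ^ (-(1 / α)) = Real.exp v := by
    rw [← Real.exp_mul]
    congr 1
    field_simp
  have habs : |-α * Real.exp (-α * v)| = α * Real.exp (-α * v) := by
    rw [abs_mul, abs_neg, abs_of_pos hα0, abs_of_pos (Real.exp_pos _)]
  set X := Real.exp (-α * v) with hXdef
  have e1 : Complex.exp (-(α * (v + π * Complex.I))) =
      X * (Real.cos (α * π) - Real.sin (α * π) * Complex.I) := by
    rw [hXdef, show -((α : ℂ) * (v + π * Complex.I)) =
      ((-α * v : ℝ) : ℂ) + ((-(α * π) : ℝ) : ℂ) * Complex.I by push_cast; ring, Complex.exp_add,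
      Complex.exp_mul_I, ← Complex.ofReal_cos, ← Complex.ofReal_sin, Real.cos_neg, Real.sin_neg,
      Complex.ofReal_exp]
    push_cast
    ring
  have e2 : Complex.exp (-(α * (v + (-π : ℝ) * Complex.I))) =
      X * (Real.cos (α * π) + Real.sin (α * π) * Complex.I) := by
    rw [hXdef, show -((α : ℂ) * (v + (-π : ℝ) * Complex.I)) =
      ((-α * v : ℝ) : ℂ) + ((α * π : ℝ) : ℂ) * Complex.I by push_cast; ring, Complex.exp_add,
      Complex.exp_mul_I, ← Complex.ofReal_cos, ← Complex.ofReal_sin, Complex.ofReal_exp]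
  have hp : |((v : ℂ) + π * Complex.I).im| ≤ π := by simp [abs_of_pos Real.pi_pos]
  have hm : |((v : ℂ) + (-π : ℝ) * Complex.I).im| ≤ π := by simp [abs_of_pos Real.pi_pos]
  have n1 := one_add_exp_ne_zero hα0 hα1 hp
  have n2 := one_add_exp_ne_zero hα0 hα1 hm
  have n3 : ((X : ℂ) ^ 2 + 2 * X * Real.cos (α * π) + 1) ≠ 0 := by
    exact_mod_cast (quadratic_pos hα0 hα1 X).ne'
  have hαc : (α : ℂ) ≠ 0 := by exact_mod_cast hα0.ne'
  have hπc : (π : ℂ) ≠ 0 := by exact_mod_cast Real.pi_ne_zero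
  have hsc : (Real.sin (α * π) : ℂ) ^ 2 + (Real.cos (α * π) : ℂ) ^ 2 = 1 := by
    exact_mod_cast Real.sin_sq_add_cos_sq (α * π)
  rw [e1] at n1
  rw [e2] at n2
  rw [stripJump, resolventIntegrand, resolventIntegrand, e1, e2, exp_add_pi_mul_I,
    exp_add_neg_pi_mul_I, habs, fKer, hX]
  have hE : Complex.exp (t * -Complex.exp v) = (Real.exp (-(t * Real.exp v)) : ℝ) := by
    push_cast
    congr 1
    ring
  rw [hE, smul_eq_mul, Complex.ofReal_mul, Complex.ofReal_div, Complex.ofReal_mul,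
    Complex.ofReal_mul, Complex.ofReal_div, Complex.ofReal_mul, Complex.ofReal_add,
    Complex.ofReal_add, Complex.ofReal_mul, Complex.ofReal_mul, Complex.ofReal_pow,
    Complex.ofReal_one, Complex.ofReal_ofNat]
  have hprod : (1 + (X : ℂ) * (Real.cos (α * π) - Real.sin (α * π) * Complex.I)) *
      (1 + X * (Real.cos (α * π) + Real.sin (α * π) * Complex.I)) =
      X ^ 2 + 2 * X * Real.cos (α * π) + 1 := by
    linear_combination (X : ℂ) ^ 2 * hsc -
      (X : ℂ) ^ 2 * (Real.sin (α * π) : ℂ) ^ 2 * Complex.I_sq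
  rw [div_sub_div _ _ n1 n2, hprod]
  field_simp
  ring

lemma hankel_resolventIntegrand {α t : ℝ} (hα0 : 0 < α) (hα1 : α < 1) (ht : 0 < t) :
    hankel (resolventIntegrand t α) =
      2 * π * Complex.I * ((∫ x in Set.Ioi (0 : ℝ), fKer x t α : ℝ) : ℂ) := by
  have hα : -α ≠ 0 := neg_ne_zero.2 hα0.ne'
  have hj : stripJump (resolventIntegrand t α) = fun v : ℝ => 2 * π * Complex.I *
      ((|-α * Real.exp (-α * v)| • fKer (Real.exp (-α * v)) t α : ℝ) : ℂ) := by
    funext v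
    exact stripJump_resolventIntegrand hα0 hα1 t v
  have hi := (integrableOn_Ioi_iff_integrable_comp_exp hα _).1 (integrableOn_fKer hα0 hα1 ht.le)
  rw [hankel_eq_integral_stripJump
    (B := fun R => Real.exp (t * Real.exp R) * (Real.exp (-α * R) - 1)⁻¹), hj,
    integral_const_mul, integral_complex_ofReal, integral_Ioi_eq_integral_comp_exp hα]
  · intro w hw
    have := one_add_exp_ne_zero hα0 hα1 hw
    unfold resolventIntegrand
    fun_prop (disch := assumption)
  · rw [hj]
    exact (hi.ofReal (𝕜 := ℂ)).const_mul _
  · have h1 : Filter.Tendsto (fun R : ℝ => Real.exp (t * Real.exp R)) Filter.atBot (nhds 1) := by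
      have := (Real.continuous_exp.tendsto _).comp (Real.tendsto_exp_atBot.const_mul t)
      simpa [Function.comp_def] using this
    have h2 : Filter.Tendsto (fun R : ℝ => Real.exp (-α * R) - 1) Filter.atBot Filter.atTop :=
      Filter.tendsto_atTop_add_const_right _ _ (Real.tendsto_exp_atTop.comp
        (Filter.tendsto_id.const_mul_atBot_of_neg (by linarith)))
    simpa using h1.mul h2.inv_tendsto_atTop
  · filter_upwards [Filter.eventually_lt_atBot 0] with R hR y
    have hnum : ‖Complex.exp (t * Complex.exp (R + y * Complex.I))‖ ≤
        Real.exp (t * Real.exp R) := by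
      have h := norm_hankelIntegrand t 0 R y
      simp only [hankelIntegrand, Complex.ofReal_zero, zero_mul, sub_zero] at h
      rw [h]
      apply Real.exp_le_exp.2
      have := mul_le_mul_of_nonneg_left (Real.cos_le_one y) (mul_pos ht (Real.exp_pos R)).le
      linarith
    have hden : Real.exp (-α * R) - 1 ≤ ‖1 + Complex.exp (-(α * (R + y * Complex.I)))‖ := by
      have h := norm_sub_norm_le (Complex.exp (-(α * (R + y * Complex.I)))) (-1)
      rw [sub_neg_eq_add, add_comm _ (1 : ℂ), norm_neg, norm_one, Complex.norm_exp] at h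
      simpa using h
    have hpos : 0 < Real.exp (-α * R) - 1 := by
      rw [sub_pos, Real.one_lt_exp_iff]
      nlinarith
    rw [resolventIntegrand, norm_div, ← div_eq_mul_inv]
    exact div_le_div₀ (Real.exp_pos _).le hnum hpos hden

theorem mittagLeffler_eq_integral_fKer (α t : ℝ) (hα0 : 0 < α) (hα1 : α < 1) (ht : 0 < t) :
    IntegrableOn (fun x : ℝ => fKer x t α) (Set.Ioi 0) ∧
    mittagLeffler α (-(t ^ α)) = ∫ x in Set.Ioi (0 : ℝ), fKer x t α := by
  refine ⟨integrableOn_fKer hα0 hα1 ht.le, ?_⟩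
  have hsum := hasSum_hankel_hankelIntegrand ht hα0
  have hterm : ∀ k : ℕ, (-1) ^ k * hankel (hankelIntegrand t (k * α)) =
      2 * π * Complex.I * (((-(t ^ α)) ^ k / Real.Gamma (k * α + 1) : ℝ) : ℂ) := by
    intro k
    rw [hankel_hankelIntegrand ht
      (lt_of_lt_of_le neg_one_lt_zero (mul_nonneg k.cast_nonneg hα0.le)), neg_pow (t ^ α),
      ← Real.rpow_mul_natCast ht.le, mul_comm α]
    push_cast
    ring
  have hne : (2 * π * Complex.I : ℂ) ≠ 0 := Complex.two_pi_I_ne_zero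
  simp only [hterm, hankel_resolventIntegrand hα0 hα1 ht] at hsum
  rw [hasSum_mul_left_iff hne] at hsum
  exact (Complex.hasSum_ofReal.1 hsum).tsum_eq
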